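/- Let v ∈ N be such that M := 𝒟v is a W-lattice, set Λ₀ = M_τ = ∑_{i≥0} τ^i(M), and assume M is self-dual, i.e. M^∨ = M. Then Λ₀^∨ = F^{g−1}(Λ₀), one has the chain of inclusions Λ₀ ⊇ M ⊇ F^{g−1}(Λ₀), and the W-modules Λ₀/M and M/F^{g−1}(Λ₀) each have length g(g−1)/2. -/

import Mathlib

noncomputable section

open WittVector
open scoped Isocrystal

variable (p : ℕ) [Fact p.Prime] (k : Type*) [Field k] [IsAlgClosed k] [CharP k p]

/-- The Frobenius automorphism `σ` of `K(p, k) = Frac(W(k))`, the unique extension of the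
Witt vector Frobenius (itself the unique lift of `x ↦ x^p` on `k`). -/
def sigmaK : K(p, k) ≃+* K(p, k) := WittVector.FractionRing.frobenius p k

variable (g : ℕ)

/-- `N = K^{2g}`: a pair `(x, y)` encodes the vector `∑ᵢ xᵢ·eᵢ + ∑ᵢ yᵢ·fᵢ` in the basis
`e_1, …, e_g, f_1, …, f_g`. -/
abbrev Nspace := (Fin g → K(p, k)) × (Fin g → K(p, k))

/-- The basis vector `e_i` (0-indexed). -/
def eVec (i : Fin g) : Nspace p k g := (Pi.single i 1, 0)

/-- The basis vector `f_i` (0-indexed). -/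
def fVec (i : Fin g) : Nspace p k g := (0, Pi.single i 1)

/-- The `σ`-semilinear Frobenius `F : N → N`, with `F(e_i) = f_i`, `F(f_i) = p·e_i`. -/
def Fmap (v : Nspace p k g) : Nspace p k g :=
  (fun i => (p : K(p, k)) * sigmaK p k (v.2 i), fun i => sigmaK p k (v.1 i))

/-- The Verschiebung `V = p·F⁻¹ : N → N`, with `V(e_i) = f_i`, `V(f_i) = p·e_i`,
`σ⁻¹`-semilinear. -/
def Vmap (v : Nspace p k g) : Nspace p k g :=
  (fun i => (p : K(p, k)) * (sigmaK p k).symm (v.2 i), fun i => (sigmaK p k).symm (v.1 i))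

/-- `τ = p⁻¹·F²` acts coordinatewise by `σ²`. -/
def tauMap (v : Nspace p k g) : Nspace p k g :=
  (fun i => sigmaK p k (sigmaK p k (v.1 i)), fun i => sigmaK p k (sigmaK p k (v.2 i)))

/-- A `W`-lattice in `N`: a finitely generated `W(k)`-submodule spanning `N` over `K`. -/
def IsLattice (L : Submodule (WittVector p k) (Nspace p k g)) : Prop :=
  L.FG ∧ Submodule.span K(p, k) (L : Set (Nspace p k g)) = ⊤

/-- A Dieudonné lattice: a `W`-lattice `M` with `F(M) ⊆ M` and `p·M ⊆ F(M)`. -/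
def IsDieudonneLattice (M : Submodule (WittVector p k) (Nspace p k g)) : Prop :=
  IsLattice p k g M ∧ (∀ v ∈ M, Fmap p k g v ∈ M) ∧
    ∀ v ∈ M, ∃ w ∈ M, Fmap p k g w = (p : K(p, k)) • v

/-- `L` is `τ`-stable: `τ(L) ⊆ L`. -/
def TauStable (L : Submodule (WittVector p k) (Nspace p k g)) : Prop :=
  ∀ v ∈ L, tauMap p k g v ∈ L

/-- `M_τ = ∑_{i ≥ 0} τ^i(M)`, the `W(k)`-submodule generated by all iterates of `τ`
applied to `M`. -/
def Mtau (M : Submodule (WittVector p k) (Nspace p k g)) :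
    Submodule (WittVector p k) (Nspace p k g) :=
  Submodule.span (WittVector p k) (⋃ i : ℕ, (tauMap p k g)^[i] '' (M : Set (Nspace p k g)))

/-- The symplectic pairing with `⟨e_i, f_{g+1−i}⟩ = 1`, `⟨f_i, e_{g+1−i}⟩ = −1` and all
other pairings of basis vectors zero. -/
def pairN (v w : Nspace p k g) : K(p, k) :=
  ∑ i : Fin g, (v.1 i * w.2 (Fin.rev i) - v.2 i * w.1 (Fin.rev i))

/-- The dual `L^∨ = {x ∈ N : ⟨x, m⟩ ∈ W for all m ∈ L}` of a set `L ⊆ N`. -/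
def dualSet (L : Set (Nspace p k g)) : Set (Nspace p k g) :=
  {x | ∀ m ∈ L, ∃ w : WittVector p k, algebraMap (WittVector p k) K(p, k) w = pairN p k g x m}

/-- `𝒟v`: the `W(k)`-submodule generated by all `F^a V^b v`, `a, b ≥ 0`. -/
def Dspan (v : Nspace p k g) : Submodule (WittVector p k) (Nspace p k g) :=
  Submodule.span (WittVector p k)
    {w | ∃ a b : ℕ, w = (Fmap p k g)^[a] ((Vmap p k g)^[b] v)}

/-! ### Lengths of subquotients -/

theorem Finset.sum_range_sub_one (g : ℕ) :
    ∑ n ∈ Finset.range (g - 1), (n + 1) = g * (g - 1) / 2 := by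
  rcases g with _ | g
  · rfl
  · have := Finset.sum_range_id_mul_two (g + 1)
    rw [Finset.sum_range_succ', Nat.add_sub_cancel] at this
    rw [Nat.add_sub_cancel]
    omega

section Length

variable {R : Type*} [CommRing R] {N : Type*} [AddCommGroup N] [Module R N]

/-- The length of `B / (A ∩ B)`. -/
def Submodule.subquotientLength (A B : Submodule R N) : ℕ∞ :=
  Module.length R (B ⧸ A.comap B.subtype)

theorem Submodule.subquotientLength_add {A B C : Submodule R N} (hAB : A ≤ B) (hBC : B ≤ C) :
    A.subquotientLength C = A.subquotientLength B + B.subquotientLength C := by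
  have h₁ : A.comap B.subtype ≤ (A.comap C.subtype).comap (Submodule.inclusion hBC) :=
    fun _ hx ↦ hx
  have h₂ : A.comap C.subtype ≤ (B.comap C.subtype).comap LinearMap.id := fun _ hx ↦ hAB hx
  refine Module.length_eq_add_of_exact (Submodule.mapQ _ _ (Submodule.inclusion hBC) h₁)
    (Submodule.mapQ _ _ LinearMap.id h₂) ?_ ?_ ?_
  · rw [← LinearMap.ker_eq_bot, Submodule.ker_mapQ, eq_bot_iff, Submodule.map_le_iff_le_comap,
      Submodule.comap_bot, Submodule.ker_mkQ]
    exact fun _ hx ↦ hx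
  · rintro ⟨x⟩
    exact ⟨Submodule.Quotient.mk x, rfl⟩
  · intro x
    obtain ⟨x, rfl⟩ := Submodule.Quotient.mk_surjective _ x
    rw [Submodule.mapQ_apply, Submodule.Quotient.mk_eq_zero]
    constructor
    · intro hx
      exact ⟨Submodule.Quotient.mk ⟨x, hx⟩, rfl⟩
    · rintro ⟨y, hy⟩
      obtain ⟨y, rfl⟩ := Submodule.Quotient.mk_surjective _ y
      rw [Submodule.mapQ_apply, Submodule.Quotient.eq] at hy
      have hyx : (y : N) - x ∈ A := hy
      have := sub_mem y.2 (hAB hyx)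
      rwa [sub_sub_cancel] at this

theorem Submodule.subquotientLength_of_covBy_chain (f : ℕ → Submodule R N) (n : ℕ)
    (h : ∀ i < n, f i ⋖ f (i + 1)) :
    f 0 ≤ f n ∧ (f 0).subquotientLength (f n) = n := by
  induction n with
  | zero => exact ⟨le_rfl, by simp [Submodule.subquotientLength]⟩
  | succ n ih =>
    obtain ⟨hle, hlen⟩ := ih fun i hi ↦ h i (by omega)
    have hn := h n (by omega)
    refine ⟨hle.trans hn.le, ?_⟩
    rw [Submodule.subquotientLength_add hle hn.le, hlen, Submodule.subquotientLength,
      Module.length_eq_one_iff.2]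
    · push_cast
      rfl
    · exact (covBy_iff_quot_is_simple hn.le).1 hn

theorem Submodule.subquotientLength_of_antitone_layers (P : ℕ → Submodule R N) (a : ℕ → ℕ) (n : ℕ)
    (hle : ∀ i < n, P (i + 1) ≤ P i)
    (h : ∀ i < n, (P (i + 1)).subquotientLength (P i) = a i) :
    P n ≤ P 0 ∧
      (P n).subquotientLength (P 0) = (∑ i ∈ Finset.range n, a i : ℕ) := by
  induction n with
  | zero => exact ⟨le_rfl, by simp [Submodule.subquotientLength]⟩
  | succ n ih =>
    obtain ⟨hle', hlen⟩ := ih (fun i hi ↦ hle i (by omega)) fun i hi ↦ h i (by omega)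
    have hn := hle n (by omega)
    refine ⟨hn.trans hle', ?_⟩
    rw [Submodule.subquotientLength_add hn hle', hlen, h n (by omega), Finset.sum_range_succ,
      add_comm]
    push_cast
    rfl

theorem exists_compositionSeries_of_length_eq {M : Type*} [AddCommGroup M] [Module R M] {n : ℕ}
    (h : Module.length R M = n) :
    ∃ s : CompositionSeries (Submodule R M), s.head = ⊥ ∧ s.last = ⊤ ∧ s.length = n := by
  have hfin : IsFiniteLength R M := Module.length_ne_top_iff.1 (by simp [h])
  obtain ⟨s, h₁, h₂⟩ := isFiniteLength_iff_exists_compositionSeries.1 hfin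
  refine ⟨s, h₁, h₂, ?_⟩
  have := Module.length_compositionSeries s h₁ h₂
  rw [h] at this
  exact_mod_cast this

/-- Adjoining one vector killed by a generator of the maximal ideal is a simple step. -/
theorem Submodule.covBy_sup_span_singleton {π : R}
    (hπ : ∀ c : R, ¬ IsUnit c → π ∣ c) {A : Submodule R N} {x : N} (hx : x ∉ A)
    (hπx : π • x ∈ A) : A ⋖ A ⊔ Submodule.span R {x} := by
  refine ⟨lt_of_le_of_ne le_sup_left fun h ↦ hx ?_, fun B hAB hB ↦ hB.not_ge ?_⟩
  · rw [h]
    exact Submodule.mem_sup_right (Submodule.mem_span_singleton_self x)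
  · obtain ⟨y, hyB, hyA⟩ := SetLike.exists_of_lt hAB
    obtain ⟨a, ha, z, hz, rfl⟩ := Submodule.mem_sup.1 (hB.le hyB)
    obtain ⟨c, rfl⟩ := Submodule.mem_span_singleton.1 hz
    have hcx : c • x ∈ B := by simpa using sub_mem hyB (hAB.le ha)
    have hc : IsUnit c := by
      by_contra hc
      obtain ⟨d, rfl⟩ := hπ c hc
      refine hyA (add_mem ha ?_)
      rw [mul_comm, mul_smul]
      exact A.smul_mem d hπx
    refine sup_le hAB.le ((Submodule.span_singleton_le_iff_mem _ _).2 ?_)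
    exact (Submodule.smul_mem_iff_of_isUnit B hc).1 hcx

/-- If an order automorphism of the lattice of submodules enlarges `L`, but all its iterates at `L`
stay inside a Noetherian submodule, then it fixes `L`. -/
theorem Submodule.eq_of_le_orderIso_of_pow_le (e : Submodule R N ≃o Submodule R N)
    {L C : Submodule R N} [IsNoetherian R C] (hL : L ≤ e L) (hC : ∀ n : ℕ, (e ^ n) L ≤ C) :
    e L = L := by
  have hmono : Monotone fun n : ℕ ↦ (e ^ n) L := monotone_nat_of_le_succ fun n ↦ by
    rw [pow_succ, RelIso.mul_apply]
    exact (e ^ n).monotone hL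
  obtain ⟨n, hn⟩ := monotone_stabilizes_iff_noetherian.2 ‹IsNoetherian R C›
    ⟨fun n ↦ ((e ^ n) L).comap C.subtype, fun _ _ h ↦ Submodule.comap_mono (hmono h)⟩
  have h := congrArg (Submodule.map C.subtype) (hn (n + 1) (by omega))
  change Submodule.map C.subtype (Submodule.comap C.subtype ((e ^ n) L)) =
    Submodule.map C.subtype (Submodule.comap C.subtype ((e ^ (n + 1)) L)) at h
  rw [Submodule.map_comap_subtype, Submodule.map_comap_subtype, inf_eq_right.2 (hC _),
    inf_eq_right.2 (hC _)] at h
  rw [pow_succ, RelIso.mul_apply] at h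
  exact ((e ^ n).injective h).symm

end Length

/-! ### Frobenius systems -/

section SemilinearOrderIso

variable {R : Type*} [CommRing R] {N : Type*} [AddCommGroup N] [Module R N]

/-- The order automorphism of the lattice of submodules given by a semilinear bijection. -/
def semilinearOrderIso (s : R ≃+* R) (e : N ≃+ N) (h : ∀ (c : R) x, e (c • x) = s c • e x) :
    Submodule R N ≃o Submodule R N :=
  Submodule.orderIsoMapComapOfBijective (σ₁₂ := (s : R →+* R))
    { toFun := e, map_add' := e.map_add, map_smul' := h } e.bijective

theorem apply_mem_semilinearOrderIso {s : R ≃+* R} {e : N ≃+ N}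
    {h : ∀ (c : R) x, e (c • x) = s c • e x} {L : Submodule R N} {x : N} :
    e x ∈ semilinearOrderIso s e h L ↔ x ∈ L :=
  ⟨fun ⟨_, hy, hyx⟩ ↦ e.injective hyx ▸ hy, fun hx ↦ ⟨x, hx, rfl⟩⟩

theorem semilinearOrderIso_span {s : R ≃+* R} {e : N ≃+ N}
    {h : ∀ (c : R) x, e (c • x) = s c • e x} (S : Set N) :
    semilinearOrderIso s e h (Submodule.span R S) = Submodule.span R (e '' S) :=
  Submodule.map_span (σ₁₂ := (s : R →+* R))
    { toFun := e, map_add' := e.map_add, map_smul' := h } S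

end SemilinearOrderIso

/-- A semilinear bijection `F` of a module, together with a semilinear bijection `T` such that
`F² = π T`. -/
structure FrobeniusSystem {R : Type*} [CommRing R] (π : R) (N : Type*) [AddCommGroup N]
    [Module R N] where
  s : R ≃+* R
  F : N ≃+ N
  T : N ≃+ N
  F_smul : ∀ (c : R) x, F (c • x) = s c • F x
  T_smul : ∀ (c : R) x, T (c • x) = s (s c) • T x
  s_pi : s π = π
  F_F : ∀ x, F (F x) = π • T x
  smul_inj : ∀ x y : N, π • x = π • y → x = y

namespace FrobeniusSystem

variable {R : Type*} [CommRing R] {π : R} {N : Type*} [AddCommGroup N] [Module R N]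
  (D : FrobeniusSystem π N)

/-- The action of `F` on submodules. -/
def mapF : Submodule R N ≃o Submodule R N := semilinearOrderIso D.s D.F D.F_smul

/-- The action of `T` on submodules. -/
def mapT : Submodule R N ≃o Submodule R N :=
  semilinearOrderIso (D.s.trans D.s) D.T D.T_smul

variable {D} in
theorem mem_mapF {L : Submodule R N} {x : N} : x ∈ D.mapF L ↔ ∃ y ∈ L, D.F y = x := Iff.rfl

variable {D} in
theorem F_mem_mapF {L : Submodule R N} {x : N} : D.F x ∈ D.mapF L ↔ x ∈ L :=
  apply_mem_semilinearOrderIso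

variable {D} in
theorem T_mem_mapT {L : Submodule R N} {x : N} : D.T x ∈ D.mapT L ↔ x ∈ L :=
  apply_mem_semilinearOrderIso

variable {D} in
theorem mem_mapF_pow {L : Submodule R N} {x : N} (n : ℕ) :
    x ∈ (D.mapF ^ n) L ↔ ∃ y ∈ L, D.F^[n] y = x := by
  induction n generalizing x with
  | zero => simp
  | succ n ih =>
    simp only [pow_succ', RelIso.mul_apply, mem_mapF, ih, Function.iterate_succ_apply']
    grind

theorem coe_mapF_pow (n : ℕ) (L : Submodule R N) :
    ((D.mapF ^ n) L : Set N) = D.F^[n] '' (L : Set N) := Set.ext fun _ ↦ mem_mapF_pow n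

variable {D} in
theorem F_iterate_mem {L : Submodule R N} {x : N} (n : ℕ) :
    D.F^[n] x ∈ (D.mapF ^ n) L ↔ x ∈ L := by
  rw [mem_mapF_pow]
  exact ⟨fun ⟨_, hy, hyx⟩ ↦ D.F.injective.iterate n hyx ▸ hy, fun hx ↦ ⟨x, hx, rfl⟩⟩

theorem mapF_span (S : Set N) : D.mapF (Submodule.span R S) = Submodule.span R (D.F '' S) :=
  semilinearOrderIso_span S

theorem mapT_span (S : Set N) : D.mapT (Submodule.span R S) = Submodule.span R (D.T '' S) :=
  semilinearOrderIso_span S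

theorem mapF_pow_span (S : Set N) (n : ℕ) :
    (D.mapF ^ n) (Submodule.span R S) = Submodule.span R (D.F^[n] '' S) := by
  induction n with
  | zero => simp
  | succ n ih =>
    rw [pow_succ', RelIso.mul_apply, ih, Function.iterate_succ', Set.image_comp, mapF_span]

theorem mapF_pow_succ (n : ℕ) (L : Submodule R N) :
    (D.mapF ^ (n + 1)) L = (D.mapF ^ n) (D.mapF L) := by
  rw [pow_succ, RelIso.mul_apply]

theorem T_symm_smul (c : R) (x : N) :
    D.T.symm (c • x) = D.s.symm (D.s.symm c) • D.T.symm x := by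
  rw [AddEquiv.symm_apply_eq, D.T_smul]
  simp

theorem F_pi_smul (x : N) : D.F (π • x) = π • D.F x := by
  rw [D.F_smul, D.s_pi]

theorem F_T (x : N) : D.F (D.T x) = D.T (D.F x) := by
  apply D.smul_inj
  rw [← D.F_pi_smul, ← D.F_F x, D.F_F (D.F x)]

theorem F_T_symm (x : N) : D.F (D.T.symm x) = D.T.symm (D.F x) := by
  rw [AddEquiv.eq_symm_apply, ← D.F_T, AddEquiv.apply_symm_apply]

theorem pi_smul (x : N) : π • x = D.F (D.F (D.T.symm x)) := by
  rw [D.F_F, AddEquiv.apply_symm_apply]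

theorem F_iterate_pi_smul (n : ℕ) (x : N) : D.F^[n] (π • x) = π • D.F^[n] x := by
  induction n with
  | zero => rfl
  | succ n ih => rw [Function.iterate_succ_apply', ih, D.F_pi_smul, Function.iterate_succ_apply']

theorem mapF_mapT (L : Submodule R N) : D.mapF (D.mapT L) = D.mapT (D.mapF L) := by
  ext x
  constructor
  · rintro ⟨_, ⟨y, hy, rfl⟩, rfl⟩
    exact ⟨D.F y, ⟨y, hy, rfl⟩, (D.F_T y).symm⟩
  · rintro ⟨_, ⟨y, hy, rfl⟩, rfl⟩
    exact ⟨D.T y, ⟨y, hy, rfl⟩, D.F_T y⟩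

/-- The translates `T⁻ʲ v`. -/
def translate (v : N) (j : ℕ) : N := D.T.symm^[j] v

theorem T_symm_translate (v : N) (j : ℕ) :
    D.T.symm (D.translate v j) = D.translate v (j + 1) :=
  (Function.iterate_succ_apply' _ _ _).symm

/-- The span of the first `i` translates. -/
def transSpan (v : N) (i : ℕ) : Submodule R N :=
  Submodule.span R {x | ∃ j < i, x = D.translate v j}

theorem translate_mem_transSpan (v : N) {i j : ℕ} (h : j < i) :
    D.translate v j ∈ D.transSpan v i := Submodule.subset_span ⟨j, h, rfl⟩

theorem transSpan_zero (v : N) : D.transSpan v 0 = ⊥ := by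
  simp [transSpan]

theorem transSpan_succ (v : N) (i : ℕ) :
    D.transSpan v (i + 1) = D.transSpan v i ⊔ Submodule.span R {D.translate v i} := by
  rw [transSpan, transSpan, ← Submodule.span_union]
  congr 1
  ext x
  simp only [Set.mem_ofPred_eq, Set.mem_union, Set.mem_singleton_iff, Nat.lt_succ_iff_lt_or_eq]
  grind

theorem transSpan_mono (v : N) : Monotone (D.transSpan v) :=
  fun _ _ h ↦ Submodule.span_mono fun _ ⟨j, hj, hx⟩ ↦ ⟨j, hj.trans_le h, hx⟩

theorem T_symm_mem_transSpan {v : N} {i : ℕ} {x : N} (hx : x ∈ D.transSpan v i) :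
    D.T.symm x ∈ D.transSpan v (i + 1) := by
  induction hx using Submodule.span_induction with
  | mem x hx =>
    obtain ⟨j, hj, rfl⟩ := hx
    rw [T_symm_translate]
    exact D.translate_mem_transSpan v (by omega)
  | zero => simp
  | add x y _ _ hx hy => rw [map_add]; exact add_mem hx hy
  | smul c x _ hx => rw [T_symm_smul]; exact Submodule.smul_mem _ _ hx

theorem mapF_pow_transSpan_succ (v : N) (n i : ℕ) :
    (D.mapF ^ n) (D.transSpan v (i + 1)) =
      (D.mapF ^ n) (D.transSpan v i) ⊔ Submodule.span R {D.F^[n] (D.translate v i)} := by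
  rw [transSpan_succ, OrderIso.map_sup, mapF_pow_span, Set.image_singleton]

/-- The cyclic submodule spanned by all `Fⁿ T⁻ʲ v` with `j ≤ n`. -/
def cyc (v : N) : Submodule R N :=
  Submodule.span R {x | ∃ n, ∃ j ≤ n, x = D.F^[n] (D.translate v j)}

/-- The part of the cyclic submodule of `F`-level at least `m`. -/
def cycFrom (v : N) (m : ℕ) : Submodule R N :=
  Submodule.span R {x | ∃ n ≥ m, ∃ j ≤ n, x = D.F^[n] (D.translate v j)}

theorem cycFrom_zero (v : N) : D.cycFrom v 0 = D.cyc v := by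
  simp [cycFrom, cyc]

theorem F_iterate_translate_mem_cycFrom (v : N) {m n j : ℕ} (h : m ≤ n) (hj : j ≤ n) :
    D.F^[n] (D.translate v j) ∈ D.cycFrom v m := Submodule.subset_span ⟨n, h, j, hj, rfl⟩

theorem cycFrom_le_cyc (v : N) (m : ℕ) : D.cycFrom v m ≤ D.cyc v :=
  Submodule.span_mono fun _ ⟨n, _, j, hj, hx⟩ ↦ ⟨n, j, hj, hx⟩

theorem mapF_pow_transSpan_le_cyc (v : N) {n i : ℕ} (h : i ≤ n + 1) :
    (D.mapF ^ n) (D.transSpan v i) ≤ D.cyc v := by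
  rw [transSpan, mapF_pow_span, Submodule.span_le]
  rintro _ ⟨_, ⟨j, hj, rfl⟩, rfl⟩
  exact Submodule.subset_span ⟨n, j, by omega, rfl⟩

theorem cycFrom_le (v : N) (m : ℕ) :
    D.cycFrom v m ≤ (D.mapF ^ m) (D.transSpan v (m + 1)) ⊔ D.cycFrom v (m + 1) := by
  rw [cycFrom, Submodule.span_le]
  rintro _ ⟨n, hn, j, hj, rfl⟩
  rcases hn.eq_or_lt with rfl | hn
  · exact Submodule.mem_sup_left
      ((F_iterate_mem _).2 (D.translate_mem_transSpan v (by omega)))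
  · exact Submodule.mem_sup_right (D.F_iterate_translate_mem_cycFrom v hn hj)

theorem pi_smul_F_iterate_translate (v : N) (n j : ℕ) :
    π • D.F^[n] (D.translate v j) = D.F^[n + 2] (D.translate v (j + 1)) := by
  rw [← F_iterate_pi_smul, pi_smul, T_symm_translate]
  rfl

end FrobeniusSystem

theorem Irreducible.dvd_of_not_isUnit {R : Type*} [CommRing R] [IsDomain R]
    [IsDiscreteValuationRing R] {π : R} (hπ : Irreducible π) (c : R) (hc : ¬ IsUnit c) : π ∣ c := by
  rwa [← Ideal.mem_span_singleton, ← hπ.maximalIdeal_eq, IsLocalRing.mem_maximalIdeal]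

namespace FrobeniusSystem

variable {R : Type*} [CommRing R] {π : R} {N : Type*} [AddCommGroup N] [Module R N]
  {D : FrobeniusSystem π N} {v : N} {Λ : Submodule R N}

/-- `Λ` is the smallest `T`-stable submodule containing the cyclic submodule of `v`. -/
structure IsHull (D : FrobeniusSystem π N) (v : N) (Λ : Submodule R N) : Prop where
  map_T : D.mapT Λ = Λ
  map_F_le : D.mapF Λ ≤ Λ
  fg : Λ.FG
  cyc_le : D.cyc v ≤ Λ
  le_of_stable : ∀ X, D.mapT X ≤ X → D.cyc v ≤ X → Λ ≤ X

namespace IsHull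

theorem T_symm_mem (h : D.IsHull v Λ) {x : N} (hx : x ∈ Λ) : D.T.symm x ∈ Λ := by
  rw [← T_mem_mapT (D := D), AddEquiv.apply_symm_apply, h.map_T]
  exact hx

theorem F_mem (h : D.IsHull v Λ) {x : N} (hx : x ∈ Λ) : D.F x ∈ Λ :=
  h.map_F_le (F_mem_mapF.2 hx)

theorem translate_mem (h : D.IsHull v Λ) (j : ℕ) : D.translate v j ∈ Λ := by
  induction j with
  | zero => exact h.cyc_le (Submodule.subset_span ⟨0, 0, le_rfl, rfl⟩)
  | succ j ih =>
    rw [← T_symm_translate]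
    exact h.T_symm_mem ih

theorem transSpan_le (h : D.IsHull v Λ) (i : ℕ) : D.transSpan v i ≤ Λ :=
  Submodule.span_le.2 fun _ ⟨j, _, hx⟩ ↦ hx ▸ h.translate_mem j

theorem mapF_pow_antitone (h : D.IsHull v Λ) : Antitone fun n : ℕ ↦ (D.mapF ^ n) Λ :=
  antitone_nat_of_succ_le fun n ↦ by
    rw [mapF_pow_succ]
    exact (D.mapF ^ n).monotone h.map_F_le

theorem pi_smul_mem (h : D.IsHull v Λ) {n : ℕ} {x : N} (hx : x ∈ (D.mapF ^ n) Λ) :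
    π • x ∈ (D.mapF ^ (n + 2)) Λ := by
  obtain ⟨y, hy, rfl⟩ := (mem_mapF_pow n).1 hx
  rw [← F_iterate_pi_smul, D.pi_smul]
  exact (mem_mapF_pow (n + 2)).2 ⟨_, h.T_symm_mem hy, rfl⟩

theorem pi_smul_mem_mapF (h : D.IsHull v Λ) {x : N} (hx : x ∈ Λ) : π • x ∈ D.mapF Λ := by
  rw [D.pi_smul]
  exact F_mem_mapF.2 (h.F_mem (h.T_symm_mem hx))

theorem exists_pi_smul_of_mem (h : D.IsHull v Λ) {n : ℕ} {x : N}
    (hx : x ∈ (D.mapF ^ (n + 2)) Λ) : ∃ y ∈ (D.mapF ^ n) Λ, x = π • y := by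
  obtain ⟨y, hy, rfl⟩ := (mem_mapF_pow (n + 2)).1 hx
  refine ⟨D.F^[n] (D.T y), (F_iterate_mem n).2 ?_, ?_⟩
  · rw [← h.map_T]
    exact T_mem_mapT.2 hy
  · rw [← F_iterate_pi_smul, ← D.F_F]
    rfl

theorem mem_mapT_mapF (h : D.IsHull v Λ) {x : N} (hx : x ∈ D.mapF Λ) :
    D.T.symm x ∈ D.mapF Λ := by
  rw [← T_mem_mapT (D := D), AddEquiv.apply_symm_apply, ← mapF_mapT, h.map_T]
  exact hx

theorem T_symm_mem_mapF_pow (h : D.IsHull v Λ) {n : ℕ} {x : N} (hx : x ∈ (D.mapF ^ n) Λ) :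
    D.T.symm x ∈ (D.mapF ^ n) Λ := by
  obtain ⟨y, hy, rfl⟩ := (mem_mapF_pow n).1 hx
  refine (mem_mapF_pow n).2 ⟨_, h.T_symm_mem hy, ?_⟩
  clear hx
  induction n with
  | zero => rfl
  | succ n ih => rw [Function.iterate_succ_apply', Function.iterate_succ_apply', ih, F_T_symm]

theorem cyc_le_translate_sup (h : D.IsHull v Λ) :
    D.cyc v ≤ Submodule.span R {v} ⊔ D.mapF Λ := by
  refine Submodule.span_le.2 ?_
  rintro _ ⟨n, j, hj, rfl⟩
  rcases n with _ | n
  · obtain rfl : j = 0 := by omega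
    exact Submodule.mem_sup_left (Submodule.mem_span_singleton_self v)
  · refine Submodule.mem_sup_right (h.mapF_pow_antitone (show 1 ≤ n + 1 by omega) ?_)
    exact (F_iterate_mem (n + 1)).2 (h.translate_mem j)

/-- Once a translate is redundant modulo `F Λ`, the previous ones generate `Λ` modulo `F Λ`. -/
theorem le_of_translate_mem [IsNoetherianRing R] (h : D.IsHull v Λ) {i : ℕ}
    (hi : D.translate v i ∈ D.transSpan v i ⊔ D.mapF Λ) : Λ ≤ D.transSpan v i ⊔ D.mapF Λ := by
  set X := D.transSpan v i ⊔ D.mapF Λ with hX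
  have hXΛ : X ≤ Λ := sup_le (h.transSpan_le i) h.map_F_le
  have hle : D.transSpan v (i + 1) ≤ X := by
    rw [transSpan_succ]
    exact sup_le le_sup_left ((Submodule.span_singleton_le_iff_mem _ _).2 hi)
  have hXT : X ≤ D.mapT X := by
    intro x hx
    rw [← D.T.apply_symm_apply x, T_mem_mapT]
    obtain ⟨u, hu, w, hw, rfl⟩ := Submodule.mem_sup.1 hx
    rw [map_add]
    exact add_mem (hle (D.T_symm_mem_transSpan hu))
      (Submodule.mem_sup_right (h.mem_mapT_mapF hw))
  have : IsNoetherian R Λ := isNoetherian_of_fg_of_noetherian Λ h.fg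
  have hpow (n : ℕ) : (D.mapT ^ n) X ≤ Λ := by
    induction n with
    | zero => simpa using hXΛ
    | succ n ih =>
      rw [pow_succ', RelIso.mul_apply, ← h.map_T]
      exact D.mapT.monotone ih
  refine h.le_of_stable X (Submodule.eq_of_le_orderIso_of_pow_le _ hXT hpow).le ?_
  refine h.cyc_le_translate_sup.trans (sup_le ?_ le_sup_right)
  exact (Submodule.span_singleton_le_iff_mem _ _).2
    (hle (D.translate_mem_transSpan v (Nat.succ_pos i)))

theorem dvd_of_sum_smul_mem (hπ : ∀ c : R, ¬ IsUnit c → π ∣ c) (h : D.IsHull v Λ) {m : ℕ}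
    (hm : ∀ i < m, D.translate v i ∉ D.transSpan v i ⊔ D.mapF Λ) {c : ℕ → R}
    (hc : ∑ i ∈ Finset.range m, c i • D.translate v i ∈ D.mapF Λ) : ∀ i < m, π ∣ c i := by
  induction m with
  | zero => simp
  | succ m ih =>
    rw [Finset.sum_range_succ] at hc
    have hcm : π ∣ c m := by
      refine hπ _ fun hu ↦ hm m (by omega) ((Submodule.smul_mem_iff_of_isUnit _ hu).1 ?_)
      rw [← add_sub_cancel_left (∑ i ∈ Finset.range m, c i • D.translate v i)
        (c m • D.translate v m)]
      refine sub_mem (Submodule.mem_sup_right hc) (Submodule.mem_sup_left ?_)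
      exact sum_mem fun i hi ↦ Submodule.smul_mem _ _
        (D.translate_mem_transSpan v (Finset.mem_range.1 hi))
    have hmem : c m • D.translate v m ∈ D.mapF Λ := by
      obtain ⟨d, hd⟩ := hcm
      rw [hd, mul_smul]
      exact h.pi_smul_mem_mapF (Λ.smul_mem d (h.translate_mem m))
    intro i hi
    rcases Nat.lt_succ_iff_lt_or_eq.1 hi with hi | rfl
    · exact ih (fun i hi ↦ hm i (by omega)) (by simpa using sub_mem hc hmem) i hi
    · exact hcm

theorem cycFrom_le_mapF_pow (h : D.IsHull v Λ) (m : ℕ) : D.cycFrom v m ≤ (D.mapF ^ m) Λ := by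
  refine Submodule.span_le.2 ?_
  rintro _ ⟨n, hn, j, _, rfl⟩
  exact h.mapF_pow_antitone hn ((F_iterate_mem n).2 (h.translate_mem j))

theorem pi_smul_mem_cycFrom {n i : ℕ} (hi : i ≤ n + 1) {x : N}
    (hx : x ∈ (D.mapF ^ n) (D.transSpan v i)) : π • x ∈ D.cycFrom v (n + 1) := by
  rw [transSpan, mapF_pow_span] at hx
  induction hx using Submodule.span_induction with
  | mem x hx =>
    obtain ⟨_, ⟨j, hj, rfl⟩, rfl⟩ := hx
    rw [pi_smul_F_iterate_translate]
    exact D.F_iterate_translate_mem_cycFrom v (by omega) (by omega)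
  | zero => simp
  | add x y _ _ hx hy => rw [smul_add]; exact add_mem hx hy
  | smul c x _ hx => rw [smul_comm]; exact Submodule.smul_mem _ _ hx

theorem F_iterate_translate_notMem {g : ℕ}
    (hm : ∀ i < g, D.translate v i ∉ D.transSpan v i ⊔ D.mapF Λ) (n : ℕ) {i : ℕ} (hi : i < g) :
    D.F^[n] (D.translate v i) ∉ (D.mapF ^ n) (D.transSpan v i) ⊔ (D.mapF ^ (n + 1)) Λ := by
  rw [mapF_pow_succ, ← OrderIso.map_sup, F_iterate_mem]
  exact hm i hi

section DVR

variable [IsDomain R] [IsDiscreteValuationRing R]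

/-- As long as the translates are irredundant modulo `F Λ`, they and their images under `F` are
linearly independent. -/
theorem linearIndependent (hπ : Irreducible π) (h : D.IsHull v Λ) {m : ℕ}
    (hm : ∀ i < m, D.translate v i ∉ D.transSpan v i ⊔ D.mapF Λ) :
    LinearIndependent R (Sum.elim (fun i : Fin m ↦ D.translate v i)
      fun i : Fin m ↦ D.F (D.translate v i)) := by
  have key (n : ℕ) : ∀ c d : ℕ → R, ∑ i ∈ Finset.range m, c i • D.translate v i +
      ∑ i ∈ Finset.range m, d i • D.F (D.translate v i) = 0 →
      ∀ i < m, π ^ n ∣ c i ∧ π ^ n ∣ d i := by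
    induction n with
    | zero => simp
    | succ n ih =>
      intro c d hcd
      have hF (e : ℕ → R) : ∑ i ∈ Finset.range m, e i • D.F (D.translate v i) =
          D.F (∑ i ∈ Finset.range m, D.s.symm (e i) • D.translate v i) := by
        simp [map_sum, D.F_smul]
      have hmem (e : ℕ → R) : ∑ i ∈ Finset.range m, e i • D.translate v i ∈ Λ :=
        sum_mem fun i _ ↦ Λ.smul_mem _ (h.translate_mem i)
      have hc : ∀ i < m, π ∣ c i := by
        refine h.dvd_of_sum_smul_mem hπ.dvd_of_not_isUnit hm ?_
        rw [eq_neg_of_add_eq_zero_left hcd, hF]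
        exact neg_mem (F_mem_mapF.2 (hmem _))
      choose! c' hc' using hc
      have hcsum : ∑ i ∈ Finset.range m, c i • D.translate v i =
          π • ∑ i ∈ Finset.range m, c' i • D.translate v i := by
        rw [Finset.smul_sum]
        refine Finset.sum_congr rfl fun i hi ↦ ?_
        rw [hc' i (Finset.mem_range.1 hi), mul_smul]
      have hd : ∀ i < m, π ∣ D.s.symm (d i) := by
        refine h.dvd_of_sum_smul_mem hπ.dvd_of_not_isUnit hm ?_
        rw [← F_mem_mapF, ← hF, eq_neg_of_add_eq_zero_right hcd, hcsum, D.pi_smul]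
        exact neg_mem (F_mem_mapF.2 (F_mem_mapF.2 (h.T_symm_mem (hmem _))))
      have hd : ∀ i < m, π ∣ d i := fun i hi ↦ by
        have := map_dvd D.s (hd i hi)
        rwa [D.s_pi, RingEquiv.apply_symm_apply] at this
      choose! d' hd' using hd
      have hdsum : ∑ i ∈ Finset.range m, d i • D.F (D.translate v i) =
          π • ∑ i ∈ Finset.range m, d' i • D.F (D.translate v i) := by
        rw [Finset.smul_sum]
        refine Finset.sum_congr rfl fun i hi ↦ ?_
        rw [hd' i (Finset.mem_range.1 hi), mul_smul]
      rw [hcsum, hdsum, ← smul_add] at hcd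
      intro i hi
      obtain ⟨h₁, h₂⟩ := ih c' d' (D.smul_inj _ _ (hcd.trans (smul_zero π).symm)) i hi
      rw [hc' i hi, hd' i hi, pow_succ']
      exact ⟨mul_dvd_mul_left _ h₁, mul_dvd_mul_left _ h₂⟩
  have hzero {c : R} (hc : ∀ n : ℕ, π ^ n ∣ c) : c = 0 := by
    by_contra hne
    exact (FiniteMultiplicity.of_not_isUnit hπ.not_isUnit hne).not_pow_dvd_of_multiplicity_lt
      (Nat.lt_succ_self _) (hc _)
  rw [Fintype.linearIndependent_iff]
  intro e he
  simp only [Fintype.sum_sum_type, Sum.elim_inl, Sum.elim_inr] at he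
  have hext (f : Fin m → R) (w : ℕ → N) : ∑ i, f i • w i =
      ∑ i ∈ Finset.range m, (if hi : i < m then f ⟨i, hi⟩ else 0) • w i := by
    rw [Finset.sum_range]
    simp
  rw [hext (fun i ↦ e (.inl i)) fun i ↦ D.translate v i,
    hext (fun i ↦ e (.inr i)) fun i ↦ D.F (D.translate v i)] at he
  have hk (n : ℕ) (i : Fin m) := key n _ _ he i i.2
  rintro (i | i)
  · exact hzero fun n ↦ by simpa using (hk n i).1
  · exact hzero fun n ↦ by simpa using (hk n i).2

end DVR

end IsHull

end FrobeniusSystem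

namespace FrobeniusSystem.IsHull

variable {R : Type*} [CommRing R] [IsDomain R] [IsDiscreteValuationRing R] {π : R}
  {N : Type*} [AddCommGroup N] [Module R N] {D : FrobeniusSystem π N} {v : N} {Λ : Submodule R N}

/-- Nakayama's lemma, with `π Λ` written as `F² Λ`. -/
theorem mapF_pow_le_of_le_sup (hπ : Irreducible π) (h : D.IsHull v Λ) {n : ℕ} {X : Submodule R N}
    (hX : (D.mapF ^ n) Λ ≤ X ⊔ (D.mapF ^ (n + 2)) Λ) : (D.mapF ^ n) Λ ≤ X := by
  have hle : (D.mapF ^ n) Λ ≤ Λ := by simpa using h.mapF_pow_antitone (Nat.zero_le n)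
  refine Submodule.le_of_le_smul_of_le_jacobson_bot (I := IsLocalRing.maximalIdeal R)
    (h.fg.of_le hle)
    (IsLocalRing.maximalIdeal_le_jacobson _) (hX.trans (sup_le_sup_left ?_ _))
  intro x hx
  obtain ⟨y, hy, rfl⟩ := h.exists_pi_smul_of_mem hx
  refine Submodule.smul_mem_smul ?_ hy
  rw [hπ.maximalIdeal_eq]
  exact Ideal.mem_span_singleton_self π

section Dimension

variable {K : Type*} [Field K] [Algebra R K] [Module K N]
  [IsScalarTower R K N] {g : ℕ}

theorem finrank_le (hπ : Irreducible π) (h : D.IsHull v Λ)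
    (hspan : Submodule.span K (Λ : Set N) = ⊤) {i : ℕ}
    (hi : Λ ≤ D.transSpan v i ⊔ D.mapF Λ) : Module.finrank K N ≤ 2 * i := by
  set w : Fin i ⊕ Fin i → N := Sum.elim (fun j : Fin i ↦ D.translate v j)
    fun j : Fin i ↦ D.F (D.translate v j) with hw
  have h₁ : D.transSpan v i ≤ Submodule.span R (Set.range w) :=
    Submodule.span_mono fun x ⟨j, hj, hx⟩ ↦ ⟨.inl ⟨j, hj⟩, hx.symm⟩
  have h₂ : D.mapF (D.transSpan v i) ≤ Submodule.span R (Set.range w) := by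
    rw [transSpan, mapF_span, Submodule.span_le]
    rintro _ ⟨_, ⟨j, hj, rfl⟩, rfl⟩
    exact Submodule.subset_span ⟨.inr ⟨j, hj⟩, rfl⟩
  have h₃ : Λ ≤ Submodule.span R (Set.range w) := by
    have := h.mapF_pow_le_of_le_sup hπ (n := 0) (X := Submodule.span R (Set.range w))
    rw [pow_zero] at this
    refine this (hi.trans (sup_le (h₁.trans le_sup_left) ((D.mapF.monotone hi).trans ?_)))
    rw [OrderIso.map_sup]
    exact sup_le (h₂.trans le_sup_left) le_sup_right
  have h₄ : Submodule.span K (Set.range w) = ⊤ := by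
    rw [eq_top_iff, ← hspan]
    exact Submodule.span_le.2 fun x hx ↦ Submodule.span_le_restrictScalars R K _ (h₃ hx)
  have := finrank_range_le_card (R := K) w
  rw [Set.finrank, h₄, finrank_top] at this
  simpa [two_mul] using this

theorem le_finrank [IsFractionRing R K] [Module.Finite K N] (hπ : Irreducible π)
    (h : D.IsHull v Λ) {m : ℕ}
    (hm : ∀ i < m, D.translate v i ∉ D.transSpan v i ⊔ D.mapF Λ) :
    2 * m ≤ Module.finrank K N := by
  have := (LinearIndependent.iff_fractionRing R K).1 (h.linearIndependent hπ hm)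
  simpa [two_mul] using this.fintype_card_le_finrank

variable (K) in
theorem translate_notMem (hπ : Irreducible π) (h : D.IsHull v Λ)
    (hspan : Submodule.span K (Λ : Set N) = ⊤) (hg : Module.finrank K N = 2 * g) {i : ℕ}
    (hi : i < g) : D.translate v i ∉ D.transSpan v i ⊔ D.mapF Λ := fun hmem ↦ by
  have := h.finrank_le hπ hspan (h.le_of_translate_mem hmem)
  omega

variable (K) in
theorem le_transSpan_sup [IsFractionRing R K] [Module.Finite K N] (hπ : Irreducible π)
    (h : D.IsHull v Λ)
    (hspan : Submodule.span K (Λ : Set N) = ⊤) (hg : Module.finrank K N = 2 * g) :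
    Λ ≤ D.transSpan v g ⊔ D.mapF Λ := by
  refine h.le_of_translate_mem ?_
  by_contra hmem
  have := h.le_finrank (K := K) hπ (m := g + 1) fun i hi ↦ by
    rcases Nat.lt_succ_iff_lt_or_eq.1 hi with hi | rfl
    · exact h.translate_notMem K hπ hspan hg hi
    · exact hmem
  omega

end Dimension

variable {g : ℕ}

theorem mapF_pow_le_cyc (hπ : Irreducible π) (h : D.IsHull v Λ)
    (hgen : Λ ≤ D.transSpan v g ⊔ D.mapF Λ) {n : ℕ} (hn : g ≤ n + 1) :
    (D.mapF ^ n) Λ ≤ D.cyc v := by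
  have hstep (m : ℕ) (hm : n ≤ m) : (D.mapF ^ m) Λ ≤ D.cyc v ⊔ (D.mapF ^ (m + 1)) Λ := by
    refine ((D.mapF ^ m).monotone hgen).trans ?_
    rw [OrderIso.map_sup, mapF_pow_succ]
    exact sup_le_sup_right (D.mapF_pow_transSpan_le_cyc v (by omega)) _
  refine h.mapF_pow_le_of_le_sup hπ ((hstep n le_rfl).trans (sup_le le_sup_left ?_))
  exact hstep (n + 1) (by omega)

/-- An element of the span of irredundant translates lying in `F Λ` is divisible by `π`. -/
theorem exists_pi_smul_of_mem_transSpan (hπ : Irreducible π) (h : D.IsHull v Λ) {m : ℕ}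
    (hm : ∀ i < m, D.translate v i ∉ D.transSpan v i ⊔ D.mapF Λ) {x : N}
    (hx : x ∈ D.transSpan v m) (hxF : x ∈ D.mapF Λ) : ∃ y ∈ D.transSpan v m, x = π • y := by
  induction m generalizing x with
  | zero =>
    rw [transSpan_zero, Submodule.mem_bot] at hx
    exact ⟨0, zero_mem _, by simp [hx]⟩
  | succ m ih =>
    rw [transSpan_succ] at hx
    obtain ⟨u, hu, w, hw, rfl⟩ := Submodule.mem_sup.1 hx
    obtain ⟨c, rfl⟩ := Submodule.mem_span_singleton.1 hw
    have hc : π ∣ c := hπ.dvd_of_not_isUnit c fun hc ↦ hm m (by omega) <|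
      (Submodule.smul_mem_iff_of_isUnit _ hc).1 <| by
        rw [← add_sub_cancel_left u (c • D.translate v m)]
        exact sub_mem (Submodule.mem_sup_right hxF) (Submodule.mem_sup_left hu)
    obtain ⟨d, rfl⟩ := hc
    have hmem : (π * d) • D.translate v m ∈ D.mapF Λ := by
      rw [mul_smul]
      exact h.pi_smul_mem_mapF (Λ.smul_mem d (h.translate_mem m))
    obtain ⟨y, hy, rfl⟩ := ih (fun i hi ↦ hm i (by omega)) hu (by simpa using sub_mem hxF hmem)
    refine ⟨y + d • D.translate v m, ?_, by rw [smul_add, mul_smul]⟩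
    exact add_mem (D.transSpan_mono v (Nat.le_succ m) hy)
      (Submodule.smul_mem _ _ (D.translate_mem_transSpan v (Nat.lt_succ_self m)))

theorem cyc_inf_le (hπ : Irreducible π) (h : D.IsHull v Λ)
    (hm : ∀ i < g, D.translate v i ∉ D.transSpan v i ⊔ D.mapF Λ) {n : ℕ} (hn : n ≤ g) :
    D.cyc v ⊓ (D.mapF ^ n) Λ ≤ D.cycFrom v n := by
  rintro x ⟨hx, hxn⟩
  have key (j : ℕ) (hj : j ≤ n) : x ∈ D.cycFrom v j := by
    induction j with
    | zero => rwa [cycFrom_zero]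
    | succ j ih =>
      obtain ⟨y, hy, z, hz, rfl⟩ := Submodule.mem_sup.1 (D.cycFrom_le v j (ih (by omega)))
      refine add_mem ?_ hz
      have hyF : y ∈ (D.mapF ^ (j + 1)) Λ := by
        rw [← add_sub_cancel_right y z]
        exact sub_mem (h.mapF_pow_antitone hj hxn) (h.cycFrom_le_mapF_pow _ hz)
      obtain ⟨y', hy', rfl⟩ := (mem_mapF_pow j).1 hy
      rw [mapF_pow_succ, F_iterate_mem] at hyF
      obtain ⟨w, hw, rfl⟩ :=
        h.exists_pi_smul_of_mem_transSpan hπ (fun i hi ↦ hm i (by omega)) hy' hyF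
      rw [F_iterate_pi_smul]
      exact pi_smul_mem_cycFrom le_rfl ((F_iterate_mem j).2 hw)
  exact key n le_rfl

theorem cyc_inf_le_sup (hπ : Irreducible π) (h : D.IsHull v Λ)
    (hm : ∀ i < g, D.translate v i ∉ D.transSpan v i ⊔ D.mapF Λ) {n : ℕ} (hn : n ≤ g) :
    D.cyc v ⊓ (D.mapF ^ n) Λ ≤
      (D.mapF ^ n) (D.transSpan v (n + 1)) ⊔ D.cycFrom v (n + 1) :=
  (h.cyc_inf_le hπ hm hn).trans (D.cycFrom_le v n)

/-- A vector all of whose negative `T`-translates lie in the cyclic submodule lies in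
`F^(g-1) Λ`. -/
theorem mem_mapF_pow_of_forall_mem (hπ : Irreducible π) (h : D.IsHull v Λ)
    (hm : ∀ i < g, D.translate v i ∉ D.transSpan v i ⊔ D.mapF Λ) {n : ℕ} (hn : n < g) {x : N}
    (hx : ∀ i : ℕ, D.T.symm^[i] x ∈ D.cyc v) : x ∈ (D.mapF ^ n) Λ := by
  induction n generalizing x with
  | zero => simpa using h.cyc_le (hx 0)
  | succ n ih =>
    have key (l : ℕ) (hl : l ≤ n + 1) : ∀ x, (∀ i : ℕ, D.T.symm^[i] x ∈ D.cyc v) →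
        x ∈ (D.mapF ^ n) (D.transSpan v (n + 1 - l)) ⊔ (D.mapF ^ (n + 1)) Λ := by
      induction l with
      | zero =>
        intro x hx
        refine sup_le_sup_left (h.cycFrom_le_mapF_pow (n + 1)) _ ?_
        exact h.cyc_inf_le_sup hπ hm (by omega) ⟨hx 0, ih (by omega) hx⟩
      | succ l ihl =>
        intro x hx
        have hx' := ihl (by omega) (D.T.symm x) fun i ↦ by
          simpa only [Function.iterate_succ_apply] using hx (i + 1)
        obtain ⟨j, hj⟩ : ∃ j, n + 1 - l = j + 1 := ⟨n - l, by omega⟩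
        have hjl : n + 1 - (l + 1) = j := by omega
        replace ihl := ihl (by omega) x hx
        rw [hj] at ihl hx'
        rw [hjl]
        rw [mapF_pow_succ, ← OrderIso.map_sup] at ihl hx' ⊢
        obtain ⟨y, hy, rfl⟩ := (mem_mapF_pow n).1 ihl
        rw [F_iterate_mem]
        have hcomm : D.T.symm (D.F^[n] y) = D.F^[n] (D.T.symm y) := by
          clear * -
          induction n with
          | zero => rfl
          | succ n ih =>
            rw [Function.iterate_succ_apply', Function.iterate_succ_apply', ← F_T_symm, ih]
        rw [hcomm, F_iterate_mem] at hx'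
        rw [transSpan_succ, sup_assoc, sup_comm (Submodule.span R _), ← sup_assoc] at hy
        obtain ⟨a, ha, b, hb, rfl⟩ := Submodule.mem_sup.1 hy
        obtain ⟨c, rfl⟩ := Submodule.mem_span_singleton.1 hb
        refine add_mem ha (Submodule.mem_sup_right ?_)
        have hc : π ∣ D.s.symm (D.s.symm c) :=
          hπ.dvd_of_not_isUnit _ fun hc ↦ hm (j + 1) (by omega) <|
          (Submodule.smul_mem_iff_of_isUnit _ hc).1 <| by
            rw [map_add, T_symm_smul, T_symm_translate] at hx'
            rw [← add_sub_cancel_left (D.T.symm a) (_ • D.translate v (j + 1))]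
            refine sub_mem hx' ?_
            obtain ⟨a₁, ha₁, a₂, ha₂, rfl⟩ := Submodule.mem_sup.1 ha
            rw [map_add]
            exact add_mem (Submodule.mem_sup_left (D.T_symm_mem_transSpan ha₁))
              (Submodule.mem_sup_right (h.mem_mapT_mapF ha₂))
        have hc' : π ∣ c := by
          have := map_dvd D.s (map_dvd D.s hc)
          rwa [D.s_pi, D.s_pi, RingEquiv.apply_symm_apply, RingEquiv.apply_symm_apply] at this
        obtain ⟨d, rfl⟩ := hc'
        rw [mul_smul]
        exact h.pi_smul_mem_mapF (Λ.smul_mem d (h.translate_mem j))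
    have := key (n + 1) le_rfl x hx
    rwa [Nat.sub_self, transSpan_zero, OrderIso.map_bot, bot_sup_eq] at this

/-! ### The lengths of the two quotients -/

theorem subquotientLength_sup_mapF_pow (hπ : Irreducible π) {X : Submodule R N} {n a l : ℕ}
    (hX : ∀ i, a ≤ i → i < a + l →
      D.F^[n] (D.translate v i) ∉ X ⊔ (D.mapF ^ n) (D.transSpan v i))
    (hπX : ∀ i, a ≤ i → i < a + l → π • D.F^[n] (D.translate v i) ∈ X) :
    (X ⊔ (D.mapF ^ n) (D.transSpan v a)).subquotientLength
      (X ⊔ (D.mapF ^ n) (D.transSpan v (a + l))) = l := by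
  refine (Submodule.subquotientLength_of_covBy_chain
    (fun i ↦ X ⊔ (D.mapF ^ n) (D.transSpan v (a + i))) l fun i hi ↦ ?_).2
  change X ⊔ (D.mapF ^ n) (D.transSpan v (a + i)) ⋖
    X ⊔ (D.mapF ^ n) (D.transSpan v (a + i + 1))
  rw [mapF_pow_transSpan_succ, ← sup_assoc]
  exact Submodule.covBy_sup_span_singleton hπ.dvd_of_not_isUnit (hX _ (by omega) (by omega))
    (Submodule.mem_sup_left (hπX _ (by omega) (by omega)))

theorem subquotientLength_hull (hπ : Irreducible π) (h : D.IsHull v Λ)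
    (hm : ∀ i < g, D.translate v i ∉ D.transSpan v i ⊔ D.mapF Λ)
    (hgen : Λ ≤ D.transSpan v g ⊔ D.mapF Λ) :
    (D.cyc v).subquotientLength Λ = (g * (g - 1) / 2 : ℕ) := by
  have hlayers := (Submodule.subquotientLength_of_antitone_layers
    (fun n ↦ D.cyc v ⊔ (D.mapF ^ n) Λ) (fun n ↦ g - 1 - n) (g - 1)
    (fun i _ ↦ sup_le_sup_left (h.mapF_pow_antitone (Nat.le_succ i)) _) fun n hn ↦ ?_).2
  · have h₀ : D.cyc v ⊔ (D.mapF ^ 0) Λ = Λ := by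
      rw [pow_zero]
      exact sup_eq_right.2 h.cyc_le
    have h₁ : D.cyc v ⊔ (D.mapF ^ (g - 1)) Λ = D.cyc v :=
      sup_eq_left.2 (h.mapF_pow_le_cyc hπ hgen (by omega))
    simp only [h₀, h₁] at hlayers
    rw [hlayers, ← Finset.sum_range_sub_one, ← Finset.sum_range_reflect]
    exact congrArg _ (Finset.sum_congr rfl fun i hi ↦ by have := Finset.mem_range.1 hi; omega)
  · have key := subquotientLength_sup_mapF_pow (D := D) (v := v) hπ
      (X := D.cyc v ⊔ (D.mapF ^ (n + 1)) Λ) (n := n) (a := n + 1) (l := g - 1 - n) ?_ ?_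
    · have h₁ : D.cyc v ⊔ (D.mapF ^ (n + 1)) Λ ⊔ (D.mapF ^ n) (D.transSpan v (n + 1)) =
          D.cyc v ⊔ (D.mapF ^ (n + 1)) Λ :=
        sup_eq_left.2 ((D.mapF_pow_transSpan_le_cyc v le_rfl).trans le_sup_left)
      have h₂ : D.cyc v ⊔ (D.mapF ^ (n + 1)) Λ ⊔
          (D.mapF ^ n) (D.transSpan v (n + 1 + (g - 1 - n))) = D.cyc v ⊔ (D.mapF ^ n) Λ := by
        rw [sup_assoc, sup_comm ((D.mapF ^ (n + 1)) Λ), mapF_pow_succ, ← OrderIso.map_sup,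
          show n + 1 + (g - 1 - n) = g by omega,
          le_antisymm (sup_le (h.transSpan_le g) h.map_F_le) hgen]
      rwa [h₁, h₂] at key
    · intro i hi hig hmem
      rw [sup_assoc] at hmem
      obtain ⟨x, hx, y, hy, hxy⟩ := Submodule.mem_sup.1 hmem
      refine F_iterate_translate_notMem hm n (i := i) (by omega) ?_
      have hyn : y ∈ (D.mapF ^ n) Λ := by
        refine sup_le (h.mapF_pow_antitone (Nat.le_succ n)) ?_ hy
        exact (D.mapF ^ n).monotone (h.transSpan_le i)
      have hxn : x ∈ (D.mapF ^ n) Λ := by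
        rw [← add_sub_cancel_right x y, hxy]
        exact sub_mem ((F_iterate_mem n).2 (h.translate_mem i)) hyn
      rw [← hxy]
      refine add_mem ?_ (by rwa [sup_comm])
      refine sup_le_sup ((D.mapF ^ n).monotone (D.transSpan_mono v hi))
        (h.cycFrom_le_mapF_pow (n + 1)) ?_
      exact h.cyc_inf_le_sup hπ hm (by omega) ⟨hx, hxn⟩
    · intro i _ _
      refine Submodule.mem_sup_right (h.mapF_pow_antitone (Nat.le_succ (n + 1)) ?_)
      exact h.pi_smul_mem ((F_iterate_mem n).2 (h.translate_mem i))

theorem subquotientLength_cyc (hπ : Irreducible π) (h : D.IsHull v Λ)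
    (hm : ∀ i < g, D.translate v i ∉ D.transSpan v i ⊔ D.mapF Λ)
    (hgen : Λ ≤ D.transSpan v g ⊔ D.mapF Λ) :
    ((D.mapF ^ (g - 1)) Λ).subquotientLength (D.cyc v) = (g * (g - 1) / 2 : ℕ) := by
  have hlayers := (Submodule.subquotientLength_of_antitone_layers
    (fun n ↦ D.cyc v ⊓ (D.mapF ^ n) Λ) (fun n ↦ n + 1) (g - 1)
    (fun i _ ↦ inf_le_inf_left _ (h.mapF_pow_antitone (Nat.le_succ i))) fun n hn ↦ ?_).2
  · have h₀ : D.cyc v ⊓ (D.mapF ^ 0) Λ = D.cyc v := by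
      rw [pow_zero]
      exact inf_eq_left.2 h.cyc_le
    have h₁ : D.cyc v ⊓ (D.mapF ^ (g - 1)) Λ = (D.mapF ^ (g - 1)) Λ :=
      inf_eq_right.2 (h.mapF_pow_le_cyc hπ hgen (by omega))
    simp only [h₀, h₁] at hlayers
    rw [hlayers, ← Finset.sum_range_sub_one]
  · have key := subquotientLength_sup_mapF_pow (D := D) (v := v) hπ
      (X := D.cyc v ⊓ (D.mapF ^ (n + 1)) Λ) (n := n) (a := 0) (l := n + 1) ?_ ?_
    · have h₁ : D.cyc v ⊓ (D.mapF ^ (n + 1)) Λ ⊔ (D.mapF ^ n) (D.transSpan v (0 + (n + 1))) =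
          D.cyc v ⊓ (D.mapF ^ n) Λ := by
        rw [zero_add]
        refine le_antisymm (sup_le ?_ ?_) ?_
        · exact inf_le_inf_left _ (h.mapF_pow_antitone (Nat.le_succ n))
        · exact le_inf (D.mapF_pow_transSpan_le_cyc v le_rfl)
            ((D.mapF ^ n).monotone (h.transSpan_le _))
        · refine (h.cyc_inf_le_sup hπ hm (by omega)).trans ?_
          rw [sup_comm]
          exact sup_le_sup_right
            (le_inf (D.cycFrom_le_cyc v _) (h.cycFrom_le_mapF_pow _)) _
      rwa [h₁, transSpan_zero, OrderIso.map_bot, sup_bot_eq] at key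
    · intro i _ hi hmem
      refine F_iterate_translate_notMem hm n (i := i) (by omega) ?_
      have hle : D.cyc v ⊓ (D.mapF ^ (n + 1)) Λ ≤ (D.mapF ^ (n + 1)) Λ := inf_le_right
      rw [sup_comm]
      exact sup_le_sup_right hle _ hmem
    · intro i _ hi
      have hi' : D.F^[n] (D.translate v i) ∈ (D.mapF ^ n) Λ :=
        (F_iterate_mem n).2 (h.translate_mem i)
      refine ⟨?_, h.mapF_pow_antitone (Nat.le_succ (n + 1)) (h.pi_smul_mem hi')⟩
      rw [pi_smul_F_iterate_translate]
      exact D.cycFrom_le_cyc v 0 (D.F_iterate_translate_mem_cycFrom v (by omega) (by omega))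

end FrobeniusSystem.IsHull

namespace FrobeniusSystem

variable {R : Type*} [CommRing R] {π : R} {N : Type*} [AddCommGroup N] [Module R N]
  (D : FrobeniusSystem π N)

theorem iterate_F_T_symm (v : N) (n : ℕ) :
    (fun x ↦ D.F (D.T.symm x))^[n] v = D.F^[n] (D.translate v n) :=
  congrFun ((show Function.Commute D.F D.T.symm from D.F_T_symm).comp_iterate n) v

theorem cyc_eq_span (v : N) : D.cyc v =
    Submodule.span R {x | ∃ a b : ℕ, x = D.F^[a] ((fun x ↦ D.F (D.T.symm x))^[b] v)} := by
  rw [cyc]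
  congr 1
  ext x
  simp only [iterate_F_T_symm, ← Function.iterate_add_apply]
  constructor
  · rintro ⟨n, j, hj, rfl⟩
    exact ⟨n - j, j, by rw [Nat.sub_add_cancel hj]⟩
  · rintro ⟨a, b, rfl⟩
    exact ⟨a + b, b, Nat.le_add_left b a, rfl⟩

theorem F_mem_cyc {v x : N} (hx : x ∈ D.cyc v) : D.F x ∈ D.cyc v := by
  have := (F_mem_mapF (D := D)).2 hx
  rw [cyc, mapF_span] at this
  refine Submodule.span_mono ?_ this
  rintro _ ⟨_, ⟨n, j, hj, rfl⟩, rfl⟩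
  exact ⟨n + 1, j, by omega, (Function.iterate_succ_apply' D.F n _).symm⟩

/-- The sum of the `T`-translates of the cyclic submodule is a hull, provided everything lies in
a `T`-stable Noetherian submodule. -/
theorem isHull_span_iUnion {v : N} {C : Submodule R N} [IsNoetherian R C] (hC : D.mapT C = C)
    (hv : D.cyc v ≤ C) :
    D.IsHull v (Submodule.span R (⋃ i : ℕ, D.T^[i] '' (D.cyc v : Set N))) := by
  set Λ := Submodule.span R (⋃ i : ℕ, D.T^[i] '' (D.cyc v : Set N)) with hΛ
  have hmem (i : ℕ) {m : N} (hm : m ∈ D.cyc v) : D.T^[i] m ∈ Λ :=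
    Submodule.subset_span (Set.mem_iUnion.2 ⟨i, m, hm, rfl⟩)
  have hmin (X : Submodule R N) (hX : D.mapT X ≤ X) (hcX : D.cyc v ≤ X) : Λ ≤ X := by
    refine Submodule.span_le.2 (Set.iUnion_subset fun i ↦ ?_)
    rintro _ ⟨m, hm, rfl⟩
    induction i with
    | zero => exact hcX hm
    | succ i ih =>
      rw [Function.iterate_succ_apply']
      exact hX (T_mem_mapT.2 ih)
  have hΛC : Λ ≤ C := hmin C hC.le hv
  have hT : D.mapT Λ ≤ Λ := by
    rw [hΛ, mapT_span, Submodule.span_le]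
    rintro _ ⟨x, hx, rfl⟩
    obtain ⟨i, m, hm, rfl⟩ := Set.mem_iUnion.1 hx
    rw [← Function.iterate_succ_apply' D.T]
    exact hmem (i + 1) hm
  refine ⟨?_, ?_, ?_, fun x hx ↦ hmem 0 hx, hmin⟩
  · have hC' : D.mapT.symm C = C := by rw [OrderIso.symm_apply_eq, hC]
    have := Submodule.eq_of_le_orderIso_of_pow_le (C := C) D.mapT.symm
      (D.mapT.le_symm_apply.2 hT) fun n ↦ by
        induction n with
        | zero => simpa using hΛC
        | succ n ih =>
          rw [pow_succ', RelIso.mul_apply, ← hC']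
          exact D.mapT.symm.monotone ih
    rw [OrderIso.symm_apply_eq] at this
    exact this.symm
  · rw [hΛ, mapF_span, Submodule.span_le]
    rintro _ ⟨x, hx, rfl⟩
    obtain ⟨i, m, hm, rfl⟩ := Set.mem_iUnion.1 hx
    rw [((show Function.Commute D.F D.T from D.F_T).iterate_right i).eq]
    exact hmem i (D.F_mem_cyc hm)
  · exact Submodule.FG.of_le_of_isNoetherian hΛC

end FrobeniusSystem

/-! ### The isocrystal -/

theorem sigmaK_algebraMap (w : WittVector p k) :
    sigmaK p k (algebraMap (WittVector p k) K(p, k) w) =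
      algebraMap (WittVector p k) K(p, k) (WittVector.frobeniusEquiv p k w) :=
  IsFractionRing.ringEquivOfRingEquiv_algebraMap _ _

theorem sigmaK_mem_range {c : K(p, k)} :
    sigmaK p k c ∈ (algebraMap (WittVector p k) K(p, k)).range ↔
      c ∈ (algebraMap (WittVector p k) K(p, k)).range := by
  constructor
  · rintro ⟨w, hw⟩
    refine ⟨(WittVector.frobeniusEquiv p k).symm w, (sigmaK p k).injective ?_⟩
    rw [sigmaK_algebraMap, RingEquiv.apply_symm_apply, hw]
  · rintro ⟨w, rfl⟩
    exact ⟨_, (sigmaK_algebraMap p k w).symm⟩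

/-- The Frobenius system on `N` given by `F` and `τ`. -/
def frobeniusSystem : FrobeniusSystem (p : WittVector p k) (Nspace p k g) where
  s := WittVector.frobeniusEquiv p k
  F :=
    { toFun := Fmap p k g
      invFun := fun x ↦ (fun i ↦ (sigmaK p k).symm (x.2 i),
        fun i ↦ (sigmaK p k).symm ((p : K(p, k))⁻¹ * x.1 i))
      left_inv := fun x ↦ by
        ext i <;> simp [Fmap, WittVector.FractionRing.p_nonzero p k]
      right_inv := fun x ↦ by
        ext i <;> simp [Fmap, WittVector.FractionRing.p_nonzero p k]
      map_add' := fun x y ↦ by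
        ext i <;> simp [Fmap, mul_add] }
  T :=
    { toFun := tauMap p k g
      invFun := fun x ↦ (fun i ↦ (sigmaK p k).symm ((sigmaK p k).symm (x.1 i)),
        fun i ↦ (sigmaK p k).symm ((sigmaK p k).symm (x.2 i)))
      left_inv := fun x ↦ by ext i <;> simp [tauMap]
      right_inv := fun x ↦ by ext i <;> simp [tauMap]
      map_add' := fun x y ↦ by ext i <;> simp [tauMap] }
  F_smul := fun c x ↦ by
    ext i <;> simp [Fmap, Algebra.smul_def, sigmaK_algebraMap, mul_left_comm]
  T_smul := fun c x ↦ by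
    ext i <;> simp [tauMap, Algebra.smul_def, sigmaK_algebraMap]
  s_pi := map_natCast _ _
  F_F := fun x ↦ by
    ext i <;> simp [Fmap, tauMap, Algebra.smul_def]
  smul_inj := fun x y h ↦ by
    have hp := WittVector.FractionRing.p_nonzero p k
    have h₁ (i : Fin g) := congrFun (congrArg Prod.fst h) i
    have h₂ (i : Fin g) := congrFun (congrArg Prod.snd h) i
    simp only [Prod.smul_fst, Prod.smul_snd, Pi.smul_apply, Algebra.smul_def (A := K(p, k)),
      map_natCast, mul_eq_mul_left_iff, hp, or_false] at h₁ h₂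
    exact Prod.ext (funext h₁) (funext h₂)

theorem Vmap_eq (x : Nspace p k g) :
    Vmap p k g x = (frobeniusSystem p k g).F ((frobeniusSystem p k g).T.symm x) := by
  change _ = Fmap p k g (fun i ↦ (sigmaK p k).symm ((sigmaK p k).symm (x.1 i)),
        fun i ↦ (sigmaK p k).symm ((sigmaK p k).symm (x.2 i)))
  ext i <;> simp [Fmap, Vmap]

theorem Dspan_eq_cyc (v : Nspace p k g) : Dspan p k g v = (frobeniusSystem p k g).cyc v := by
  rw [FrobeniusSystem.cyc_eq_span, ← funext (Vmap_eq p k g)]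
  rfl

/-- The lattice of vectors with integral coordinates. -/
def integralLattice : Submodule (WittVector p k) (Nspace p k g) :=
  LinearMap.range (LinearMap.prodMap ((Algebra.linearMap (WittVector p k) K(p, k)).compLeft (Fin g))
    ((Algebra.linearMap (WittVector p k) K(p, k)).compLeft (Fin g)))

set_option linter.unusedSectionVars false in
theorem mem_integralLattice {x : Nspace p k g} : x ∈ integralLattice p k g ↔
    (∀ i, x.1 i ∈ (algebraMap (WittVector p k) K(p, k)).range) ∧
      ∀ i, x.2 i ∈ (algebraMap (WittVector p k) K(p, k)).range := by
  constructor
  · rintro ⟨y, rfl⟩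
    exact ⟨fun i ↦ ⟨y.1 i, rfl⟩, fun i ↦ ⟨y.2 i, rfl⟩⟩
  · rintro ⟨h₁, h₂⟩
    choose a ha using h₁
    choose b hb using h₂
    exact ⟨(a, b), Prod.ext (funext ha) (funext hb)⟩

/-- The lattice `p⁻ⁿ L`, where `L` is the lattice of vectors with integral coordinates. -/
def scaledLattice (n : ℕ) : Submodule (WittVector p k) (Nspace p k g) :=
  (integralLattice p k g).comap
    (LinearMap.lsmul (WittVector p k) (Nspace p k g) ((p : WittVector p k) ^ n))

set_option linter.unusedSectionVars false in
theorem mem_scaledLattice {n : ℕ} {x : Nspace p k g} :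
    x ∈ scaledLattice p k g n ↔ ((p : WittVector p k) ^ n) • x ∈ integralLattice p k g := Iff.rfl

instance (n : ℕ) : IsNoetherian (WittVector p k) (scaledLattice p k g n) := by
  have : IsNoetherian (WittVector p k) (integralLattice p k g) :=
    isNoetherian_of_surjective (LinearMap.rangeRestrict _) (LinearMap.range_rangeRestrict _)
  refine isNoetherian_of_injective
    ((LinearMap.lsmul (WittVector p k) (Nspace p k g) ((p : WittVector p k) ^ n)).restrict
      (p := scaledLattice p k g n) (q := integralLattice p k g) fun _ h ↦ h) fun x y h ↦ ?_
  have h' : (p : WittVector p k) ^ n • (x : Nspace p k g) =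
      (p : WittVector p k) ^ n • (y : Nspace p k g) :=
    congrArg Subtype.val h
  have hinj (m : ℕ) : Function.Injective fun z : Nspace p k g ↦ (p : WittVector p k) ^ m • z := by
    induction m with
    | zero => intro a b hab; simpa using hab
    | succ m ih =>
      intro a b hab
      simp only [pow_succ, mul_smul] at hab
      exact (frobeniusSystem p k g).smul_inj _ _ (ih hab)
  exact Subtype.ext (hinj n h')

theorem tauMap_mem_scaledLattice {n : ℕ} {x : Nspace p k g} :
    tauMap p k g x ∈ scaledLattice p k g n ↔ x ∈ scaledLattice p k g n := by
  have h : (p : WittVector p k) ^ n • tauMap p k g x =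
      tauMap p k g ((p : WittVector p k) ^ n • x) := by
    have := (frobeniusSystem p k g).T_smul ((p : WittVector p k) ^ n) x
    rw [map_pow, map_pow, (frobeniusSystem p k g).s_pi, (frobeniusSystem p k g).s_pi] at this
    exact this.symm
  rw [mem_scaledLattice, mem_scaledLattice, h, mem_integralLattice, mem_integralLattice]
  simp only [tauMap, sigmaK_mem_range]

theorem mapT_scaledLattice (n : ℕ) :
    (frobeniusSystem p k g).mapT (scaledLattice p k g n) = scaledLattice p k g n := by
  ext x
  rw [← (frobeniusSystem p k g).T.apply_symm_apply x, FrobeniusSystem.T_mem_mapT]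
  exact (tauMap_mem_scaledLattice p k g).symm

set_option linter.unusedSectionVars false in
theorem scaledLattice_mono : Monotone (scaledLattice p k g) :=
  monotone_nat_of_le_succ fun n x hx ↦ by
    rw [mem_scaledLattice, pow_succ', mul_smul]
    exact Submodule.smul_mem _ _ hx

theorem exists_mem_scaledLattice (x : Nspace p k g) : ∃ n, x ∈ scaledLattice p k g n := by
  obtain ⟨b, hb⟩ := IsLocalization.exist_integer_multiples_of_finite
    (nonZeroDivisors (WittVector p k)) (Sum.elim x.1 x.2)
  obtain ⟨n, u, hu⟩ :=
    WittVector.exists_eq_pow_p_mul' (b : WittVector p k) (nonZeroDivisors.coe_ne_zero b)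
  refine ⟨n, ?_⟩
  have hmem : (b : WittVector p k) • x ∈ integralLattice p k g :=
    (mem_integralLattice p k g).2 ⟨fun i ↦ hb (.inl i), fun i ↦ hb (.inr i)⟩
  rwa [hu, mul_comm, mul_smul, Submodule.smul_mem_iff_of_isUnit _ u.isUnit] at hmem

theorem exists_le_scaledLattice {L : Submodule (WittVector p k) (Nspace p k g)} (hL : L.FG) :
    ∃ n, L ≤ scaledLattice p k g n := by
  induction L, hL using Submodule.fg_induction with
  | singleton x =>
    obtain ⟨n, hn⟩ := exists_mem_scaledLattice p k g x
    exact ⟨n, (Submodule.span_singleton_le_iff_mem _ _).2 hn⟩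
  | sup L₁ L₂ _ _ h₁ h₂ =>
    obtain ⟨n₁, h₁⟩ := h₁
    obtain ⟨n₂, h₂⟩ := h₂
    exact ⟨max n₁ n₂, sup_le (h₁.trans (scaledLattice_mono p k g (le_max_left _ _)))
      (h₂.trans (scaledLattice_mono p k g (le_max_right _ _)))⟩

theorem isHull_Mtau {v : Nspace p k g} (hv : (Dspan p k g v).FG) :
    (frobeniusSystem p k g).IsHull v (Mtau p k g (Dspan p k g v)) := by
  rw [Dspan_eq_cyc] at hv ⊢
  obtain ⟨n, hn⟩ := exists_le_scaledLattice p k g hv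
  exact (frobeniusSystem p k g).isHull_span_iUnion (mapT_scaledLattice p k g n) hn

/-! ### Duality -/

theorem pairN_tauMap (x y : Nspace p k g) :
    pairN p k g (tauMap p k g x) (tauMap p k g y) = sigmaK p k (sigmaK p k (pairN p k g x y)) := by
  simp [pairN, tauMap]

theorem pairN_tauMap_mem_range {x y : Nspace p k g} :
    pairN p k g (tauMap p k g x) (tauMap p k g y) ∈ (algebraMap (WittVector p k) K(p, k)).range ↔
      pairN p k g x y ∈ (algebraMap (WittVector p k) K(p, k)).range := by
  rw [pairN_tauMap, sigmaK_mem_range, sigmaK_mem_range]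

/-- The dual of a set, as a submodule of the second argument of the pairing. -/
def rightDual (S : Set (Nspace p k g)) : Submodule (WittVector p k) (Nspace p k g) where
  carrier := {y | ∀ x ∈ S, pairN p k g x y ∈ (algebraMap (WittVector p k) K(p, k)).range}
  zero_mem' x _ := by simp [pairN]
  add_mem' {y z} hy hz x hx := by
    convert add_mem (hy x hx) (hz x hx) using 1
    simp only [pairN, ← Finset.sum_add_distrib, Prod.fst_add, Prod.snd_add, Pi.add_apply]
    exact Finset.sum_congr rfl fun _ _ ↦ by ring
  smul_mem' c y hy x hx := by
    have hc : algebraMap (WittVector p k) K(p, k) c ∈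
        (algebraMap (WittVector p k) K(p, k)).range := ⟨c, rfl⟩
    convert mul_mem hc (hy x hx) using 1
    simp only [pairN, Finset.mul_sum, Prod.smul_fst, Prod.smul_snd, Pi.smul_apply,
      Algebra.smul_def (A := K(p, k))]
    exact Finset.sum_congr rfl fun _ _ ↦ by ring

theorem dualSet_eq_mapF_pow {v : Nspace p k g} {Λ : Submodule (WittVector p k) (Nspace p k g)}
    (h : (frobeniusSystem p k g).IsHull v Λ)
    (hm : ∀ i < g, (frobeniusSystem p k g).translate v i ∉
      (frobeniusSystem p k g).transSpan v i ⊔ (frobeniusSystem p k g).mapF Λ)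
    (hgen : Λ ≤ (frobeniusSystem p k g).transSpan v g ⊔ (frobeniusSystem p k g).mapF Λ)
    (hg : 1 ≤ g)
    (hdual : dualSet p k g ((frobeniusSystem p k g).cyc v : Set (Nspace p k g)) =
      (frobeniusSystem p k g).cyc v) :
    dualSet p k g Λ = ((frobeniusSystem p k g).mapF ^ (g - 1)) Λ := by
  set D := frobeniusSystem p k g with hD
  have hπ : Irreducible (p : WittVector p k) := WittVector.irreducible p
  refine subset_antisymm (fun x hx ↦ ?_) ?_
  · refine h.mem_mapF_pow_of_forall_mem hπ hm (by omega) fun i ↦ ?_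
    have hi : D.T.symm^[i] x ∈ dualSet p k g Λ := by
      induction i with
      | zero => exact hx
      | succ i ih =>
        rw [Function.iterate_succ_apply']
        intro m hmΛ
        refine (pairN_tauMap_mem_range p k g).1 ?_
        change pairN p k g (D.T (D.T.symm _)) (D.T m) ∈ _
        rw [AddEquiv.apply_symm_apply]
        refine ih _ ?_
        rw [← h.map_T]
        exact FrobeniusSystem.T_mem_mapT.2 hmΛ
    rw [← SetLike.mem_coe, ← hdual]
    exact fun m hm ↦ hi m (h.cyc_le hm)
  · have hle : Λ ≤ rightDual p k g ((D.mapF ^ (g - 1)) Λ) := by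
      refine h.le_of_stable _ ?_ fun y hy x hx ↦ ?_
      · intro y hy x hx
        rw [← D.T.apply_symm_apply y, FrobeniusSystem.T_mem_mapT] at hy
        have := (pairN_tauMap_mem_range p k g).2 (hy _ (h.T_symm_mem_mapF_pow hx))
        change pairN p k g (D.T (D.T.symm x)) (D.T (D.T.symm y)) ∈ _ at this
        rwa [AddEquiv.apply_symm_apply, AddEquiv.apply_symm_apply] at this
      · have hx' := h.mapF_pow_le_cyc hπ hgen (by omega) hx
        rw [← SetLike.mem_coe, ← hdual] at hx'
        exact hx' y hy
    exact fun x hx y hy ↦ hle hy x hx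

/-- Let `v ∈ N` be such that `M := 𝒟v` is a `W`-lattice, `Λ₀ = M_τ`, and
assume `M` is self-dual (`M^∨ = M`). Then `Λ₀^∨ = F^{g−1}(Λ₀)`, one has
`Λ₀ ⊇ M ⊇ F^{g−1}(Λ₀)`, and the `W`-modules `Λ₀/M` and `M/F^{g−1}(Λ₀)` each have
length `g(g−1)/2` (expressed via composition series from `⊥` to `⊤`). -/
theorem stmt11 (hg : 1 ≤ g) (v : Nspace p k g) (hv : IsLattice p k g (Dspan p k g v))
    (hselfdual : dualSet p k g (Dspan p k g v : Set (Nspace p k g))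
      = (Dspan p k g v : Set (Nspace p k g))) :
    dualSet p k g (Mtau p k g (Dspan p k g v) : Set (Nspace p k g))
        = (Fmap p k g)^[g - 1] '' (Mtau p k g (Dspan p k g v) : Set (Nspace p k g)) ∧
    Dspan p k g v ≤ Mtau p k g (Dspan p k g v) ∧
    (Fmap p k g)^[g - 1] '' (Mtau p k g (Dspan p k g v) : Set (Nspace p k g))
        ⊆ (Dspan p k g v : Set (Nspace p k g)) ∧
    (∃ s : CompositionSeries (Submodule (WittVector p k)
        (↥(Mtau p k g (Dspan p k g v)) ⧸
          (Submodule.comap (Mtau p k g (Dspan p k g v)).subtype (Dspan p k g v)))),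
      s.head = ⊥ ∧ s.last = ⊤ ∧ s.length = g * (g - 1) / 2) ∧
    (∃ s : CompositionSeries (Submodule (WittVector p k)
        (↥(Dspan p k g v) ⧸
          (Submodule.comap (Dspan p k g v).subtype
            (Submodule.span (WittVector p k)
              ((Fmap p k g)^[g - 1]
                '' (Mtau p k g (Dspan p k g v) : Set (Nspace p k g))))))),
      s.head = ⊥ ∧ s.last = ⊤ ∧ s.length = g * (g - 1) / 2) := by
  have hπ : Irreducible (p : WittVector p k) := WittVector.irreducible p
  have h := isHull_Mtau p k g hv.1
  have hcyc := Dspan_eq_cyc p k g v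
  have hle := h.cyc_le
  rw [← hcyc] at hle
  have hspan : Submodule.span K(p, k) (Mtau p k g (Dspan p k g v) : Set (Nspace p k g)) = ⊤ := by
    rw [eq_top_iff, ← hv.2]
    exact Submodule.span_mono hle
  have hrank : Module.finrank K(p, k) (Nspace p k g) = 2 * g := by
    rw [Module.finrank_prod, Module.finrank_fin_fun, two_mul]
  have hm (i : ℕ) (hi : i < g) := h.translate_notMem K(p, k) hπ hspan hrank hi
  have hgen := h.le_transSpan_sup K(p, k) hπ hspan hrank
  have himage : (Fmap p k g)^[g - 1] '' (Mtau p k g (Dspan p k g v) : Set (Nspace p k g)) =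
      ((frobeniusSystem p k g).mapF ^ (g - 1)) (Mtau p k g (Dspan p k g v)) :=
    ((frobeniusSystem p k g).coe_mapF_pow (g - 1) _).symm
  have hdual := dualSet_eq_mapF_pow p k g h hm hgen hg (hcyc ▸ hselfdual)
  have hle' := h.mapF_pow_le_cyc hπ hgen (n := g - 1) (by omega)
  have hlen := h.subquotientLength_hull hπ hm hgen
  have hlen' := h.subquotientLength_cyc hπ hm hgen
  rw [← hcyc] at hle' hlen hlen'
  rw [← Submodule.span_eq (((frobeniusSystem p k g).mapF ^ (g - 1)) _), ← himage] at hlen'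
  exact ⟨hdual.trans himage.symm, hle, himage.le.trans hle',
    exists_compositionSeries_of_length_eq hlen, exists_compositionSeries_of_length_eq hlen'⟩
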